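/- Let G be a finite graph with vertex set {v₁, …, v_n} and consider the Feder construction. For every independent set S of G, the matching M = {{p_i, q̄_i}, {q_i, p̄_i} : v_i ∈ S} ∪ {{p_i, p̄_i}, {q_i, q̄_i} : v_i ∉ S} is a stable matching for the profile P₂. -/

import Mathlib

/-- The agents of the Feder construction: for each vertex `v` there are four
agents `p v`, `pbar v`, `q v`, `qbar v`. -/
inductive FAgent (V : Type*) where
  | p (v : V)
  | pbar (v : V)
  | q (v : V)
  | qbar (v : V)

/-- A matching on a set of agents: a set of non-diagonal unordered pairs
that are pairwise disjoint. -/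
def IsMatching {α : Type*} (M : Set (Sym2 α)) : Prop :=
  (∀ e ∈ M, ¬ e.IsDiag) ∧ M.Pairwise fun e f => ∀ a, a ∈ e → a ∉ f

namespace FAgent

variable {V : Type*}

/-- Mutual acceptability in the Feder construction (the same in both profiles
`P₁` and `P₂`): `p i` accepts `pbar i`, `qbar i` and the agents `p j` for
neighbors `v_j` of `v_i`; `pbar i` accepts `q i` and `p i`; `q i` accepts
`qbar i` and `pbar i`; `qbar i` accepts `p i` and `q i`. -/
def acc (G : SimpleGraph V) : FAgent V → FAgent V → Prop
  | .p i, x => x = .pbar i ∨ x = .qbar i ∨ ∃ j, G.Adj i j ∧ x = .p j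
  | .pbar i, x => x = .q i ∨ x = .p i
  | .q i, x => x = .qbar i ∨ x = .pbar i
  | .qbar i, x => x = .p i ∨ x = .q i

/-- The strict preferences of profile `P₁`:
`p i : pbar i ≻ qbar i ≻ [p j for neighbors v_j, in the fixed order given by `<`]`;
`pbar i : q i ≻ p i`; `q i : qbar i ≻ pbar i`; `qbar i : p i ≻ q i`. -/
def pref1 (G : SimpleGraph V) [LT V] : FAgent V → FAgent V → FAgent V → Prop
  | .p i, .pbar i', .qbar i'' => i' = i ∧ i'' = i
  | .p i, .pbar i', .p j => i' = i ∧ G.Adj i j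
  | .p i, .qbar i', .p j => i' = i ∧ G.Adj i j
  | .p i, .p j, .p k => G.Adj i j ∧ G.Adj i k ∧ j < k
  | .pbar i, x, y => x = .q i ∧ y = .p i
  | .q i, x, y => x = .qbar i ∧ y = .pbar i
  | .qbar i, x, y => x = .p i ∧ y = .q i
  | _, _, _ => False

/-- The strict preferences of profile `P₂`:
`p i : pbar i ≻ [p j for neighbors v_j, in the fixed order given by `<`] ≻ qbar i`;
`pbar i : q i ≻ p i`; `q i : qbar i ≻ pbar i`; `qbar i : p i ≻ q i`. -/
def pref2 (G : SimpleGraph V) [LT V] : FAgent V → FAgent V → FAgent V → Prop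
  | .p i, .pbar i', .p j => i' = i ∧ G.Adj i j
  | .p i, .pbar i', .qbar i'' => i' = i ∧ i'' = i
  | .p i, .p j, .qbar i' => G.Adj i j ∧ i' = i
  | .p i, .p j, .p k => G.Adj i j ∧ G.Adj i k ∧ j < k
  | .pbar i, x, y => x = .q i ∧ y = .p i
  | .q i, x, y => x = .qbar i ∧ y = .pbar i
  | .qbar i, x, y => x = .p i ∧ y = .q i
  | _, _, _ => False

end FAgent

/-- A stable matching with respect to an acceptability relation `acc` and a strict
preference relation `pref`: `M` is a matching of mutually acceptable agents admitting
no blocking pair.  A pair `{a,b}` of mutually acceptable agents blocks `M` if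
`{a,b} ∉ M`, `a` is unmatched or prefers `b` to its partner, and `b` is unmatched or
prefers `a` to its partner. -/
def IsStable {A : Type*} (acc : A → A → Prop) (pref : A → A → A → Prop)
    (M : Set (Sym2 A)) : Prop :=
  IsMatching M ∧ (∀ a b : A, s(a, b) ∈ M → acc a b ∧ acc b a) ∧
  ∀ a b : A, a ≠ b → acc a b → acc b a → s(a, b) ∉ M →
    ¬ ((∀ c, s(a, c) ∈ M → pref a b c) ∧ (∀ c, s(b, c) ∈ M → pref b a c))

namespace FAgent

variable {V : Type*}

/-- The partner of an agent in the matching associated with the vertex set `S`. -/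
noncomputable def partner (S : Set V) : FAgent V → FAgent V := by
  classical
  exact fun
    | .p i => if i ∈ S then .qbar i else .pbar i
    | .pbar i => if i ∈ S then .q i else .p i
    | .q i => if i ∈ S then .pbar i else .qbar i
    | .qbar i => if i ∈ S then .p i else .q i

theorem partner_partner (S : Set V) (a : FAgent V) : partner S (partner S a) = a := by
  cases a with | _ i => by_cases h : i ∈ S <;> simp [partner, h]

theorem partner_ne (S : Set V) (a : FAgent V) : partner S a ≠ a := by
  cases a with | _ i => by_cases h : i ∈ S <;> simp [partner, h]

theorem acc_partner (G : SimpleGraph V) (S : Set V) (a : FAgent V) : acc G a (partner S a) := by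
  cases a with | _ i => by_cases h : i ∈ S <;> simp [acc, partner, h]

theorem mk_mem_iff (S : Set V) (a b : FAgent V) :
    s(a, b) ∈ ({e | ∃ i ∈ S, e = s(p i, qbar i) ∨ e = s(q i, pbar i)} ∪
      {e | ∃ i, i ∉ S ∧ (e = s(p i, pbar i) ∨ e = s(q i, qbar i))}) ↔ partner S a = b := by
  cases a with | _ i => cases b with | _ j => by_cases h : i ∈ S <;> simp [partner, h] <;> grind

/-- In profile `P₂`, no acceptable pair of agents improves on their partners, provided that `S`
is independent. -/
theorem not_pref2_partner [LinearOrder V] {G : SimpleGraph V} {S : Set V}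
    (hS : S.Pairwise fun a b => ¬ G.Adj a b) (a b : FAgent V) (hab : acc G a b) :
    ¬ (pref2 G a b (partner S a) ∧ pref2 G b a (partner S b)) := by
  have hS' (i j : V) (hi : i ∈ S) (hj : j ∈ S) : ¬ G.Adj i j := fun h => hS hi hj h.ne h
  cases a with | _ i => cases b with | _ j =>
    by_cases hi : i ∈ S <;> by_cases hj : j ∈ S <;> simp [partner, pref2, acc, hi, hj] at hab ⊢ <;>
      grind

end FAgent

theorem isMatching_of_forall_mk_mem_iff {α : Type*} {M : Set (Sym2 α)} {f : α → α}
    (hf : ∀ a, f a ≠ a) (hM : ∀ a b, s(a, b) ∈ M ↔ f a = b) : IsMatching M := by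
  refine ⟨fun e he hd => ?_, fun e he e' he' hne a ha ha' => hne ?_⟩
  · induction e with | _ a b =>
    rw [Sym2.mk_isDiag_iff] at hd
    exact hf a (((hM a b).1 he).trans hd.symm)
  · obtain ⟨b, rfl⟩ := ha
    obtain ⟨c, rfl⟩ := ha'
    rw [← (hM a b).1 he, ← (hM a c).1 he']

/-- for every independent set `S` of `G`, the matching
`M = {{p i, qbar i}, {q i, pbar i} : v_i ∈ S} ∪ {{p i, pbar i}, {q i, qbar i} : v_i ∉ S}`
is a stable matching for the profile `P₂` of the Feder construction. -/
theorem statement_18 {V : Type*} [Fintype V] [LinearOrder V] (G : SimpleGraph V)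
    (S : Set V) (hS : S.Pairwise fun a b => ¬ G.Adj a b) :
    IsStable (FAgent.acc G) (FAgent.pref2 G)
      ({e | ∃ i ∈ S, e = s(FAgent.p i, FAgent.qbar i) ∨ e = s(FAgent.q i, FAgent.pbar i)} ∪
       {e | ∃ i, i ∉ S ∧ (e = s(FAgent.p i, FAgent.pbar i) ∨ e = s(FAgent.q i, FAgent.qbar i))}) := by
  have hM := FAgent.mk_mem_iff S
  refine ⟨isMatching_of_forall_mk_mem_iff (FAgent.partner_ne S) hM, fun a b h => ?_,
    fun a b _ hab _ _ h => ?_⟩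
  · obtain rfl := (hM a b).1 h
    refine ⟨FAgent.acc_partner G S a, ?_⟩
    simpa only [FAgent.partner_partner] using FAgent.acc_partner G S (FAgent.partner S a)
  · exact FAgent.not_pref2_partner hS a b hab
      ⟨h.1 _ ((hM a _).2 rfl), h.2 _ ((hM b _).2 rfl)⟩
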